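/- arXiv:0912.5306 — 3 statements merged into one kernel-verified Lean document; each statement's English description precedes it below -/
import Mathlib

section
/- Let K>0 and let ν be a probability measure on [0,∞) with ν({0})=0 and finite mean β=∫x ν(dx); let F be its CDF and F_e the CDF of its equilibrium measure ν_e. Let h₁, h₂ : [0,∞) → [0,∞) with h₁(u) ≤ h₂(u) for all u ≥ 0 and h₁(0) < h₂(0), and let x₁, x₂ be right-continuous solutions with left limits of the renewal-type integral equation x_i(u) = h_i(u) + ∫_{[0,u]} (x_i(u−v)−K)⁺ dF(v) + ∫_{[0,u]} (x_i(u−v) ∧ K) dF_e(v), i=1,2. Then x₁(u) ≤ x₂(u) for all u ≥ 0. -/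
open MeasureTheory Set Filter
open scoped ENNReal NNReal Topology

/-- Total mass `⟨1, m⟩` of a finite Borel measure on `[0,∞)` (modeled as a measure on `ℝ`). -/
noncomputable def totalMass (m : Measure ℝ) : ℝ := (m Set.univ).toReal

/-- First moment `⟨χ, m⟩ = ∫ x dm(x)` of a measure. -/
noncomputable def firstMoment (m : Measure ℝ) : ℝ := ∫ x, x ∂m

/-- The equilibrium measure `ν_e` of `ν`, defined by `ν_e([0,x]) = (1/β)∫₀ˣ ν((y,∞)) dy`
where `β` is the mean of `ν`. -/
noncomputable def eqMeasure (ν : Measure ℝ) : Measure ℝ :=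
  (ENNReal.ofReal (firstMoment ν))⁻¹ •
    ((volume.restrict (Set.Ici (0:ℝ))).withDensity fun y => ν (Set.Ioi y))

/-- The mean `β_e` of the equilibrium measure of `ν`. -/
noncomputable def meanE (ν : Measure ℝ) : ℝ := firstMoment (eqMeasure ν)

/-- The input function `h_{ξ,μ}(u) = ξ(A_u) + μ(A_u)` of the renewal-type equation. -/
noncomputable def hFun (ξ μ : Measure ℝ) (u : ℝ) : ℝ :=
  (ξ (Set.Ioi u)).toReal + (μ (Set.Ioi u)).toReal

/-- The renewal-type integral equation
`x(u) = h(u) + ∫_{[0,u]} (x(u−v)−K)⁺ dF(v) + ∫_{[0,u]} (x(u−v) ∧ K) dF_e(v)`,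
where the Lebesgue–Stieltjes integrals against the CDFs `F`, `F_e` are integrals
against the measures `ν` and `ν_e`. -/
def RenewalEqn (K : ℝ) (ν : Measure ℝ) (h x : ℝ → ℝ) : Prop :=
  ∀ u : ℝ, 0 ≤ u →
    x u = h u + (∫ v in Set.Icc 0 u, max (x (u - v) - K) 0 ∂ν)
        + ∫ v in Set.Icc 0 u, min (x (u - v)) K ∂(eqMeasure ν)

/-- A real-valued function on `[0,∞)` that is right continuous with left limits. -/
def Cadlag (x : ℝ → ℝ) : Prop :=
  (∀ t : ℝ, 0 ≤ t → ContinuousWithinAt x (Set.Ici t) t) ∧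
  (∀ t : ℝ, 0 < t → ∃ l : ℝ, Filter.Tendsto x (nhdsWithin t (Set.Iio t)) (nhds l))

/-- `x(∞) = (w − Kβ_e)⁺/β + (w ∧ Kβ_e)/β_e`, the equilibrium fluid system size
corresponding to workload `w`. -/
noncomputable def xInf (K : ℝ) (ν : Measure ℝ) (w : ℝ) : ℝ :=
  max (w - K * meanE ν) 0 / firstMoment ν + min w (K * meanE ν) / meanE ν

theorem measurable_of_continuousWithinAt_Ici {f : ℝ → ℝ}
    (hf : ∀ t, ContinuousWithinAt f (Ici t) t) : Measurable f := by
  have key : ∀ n : ℕ, Measurable fun t : ℝ => f ((⌊t * (n + 1)⌋ + 1 : ℝ) / (n + 1)) := by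
    intro n
    have hfloor : Measurable fun t : ℝ => ⌊t * ((n : ℝ) + 1)⌋ :=
      Int.measurable_floor.comp (measurable_id.mul_const _)
    exact (measurable_from_top (f := fun k : ℤ => f (((k : ℝ) + 1) / (n + 1)))).comp hfloor
  refine measurable_of_tendsto_metrizable key (tendsto_pi_nhds.2 fun t => ?_)
  refine (hf t).tendsto.comp (tendsto_nhdsWithin_iff.2 ⟨?_, Eventually.of_forall fun n => ?_⟩)
  · have hlim : Tendsto (fun n : ℕ => t + 1 / ((n : ℝ) + 1)) atTop (𝓝 t) := by
      simpa using tendsto_one_div_add_atTop_nhds_zero_nat.const_add t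
    refine tendsto_of_tendsto_of_tendsto_of_le_of_le tendsto_const_nhds hlim
      (fun n => ?_) (fun n => ?_)
    · have hn : (0 : ℝ) < n + 1 := by positivity
      exact (le_div_iff₀ hn).2 (Int.lt_floor_add_one _).le
    · have hn : (0 : ℝ) < n + 1 := by positivity
      have := Int.floor_le (t * ((n : ℝ) + 1))
      change (⌊t * ((n : ℝ) + 1)⌋ + 1 : ℝ) / (n + 1) ≤ t + 1 / (n + 1)
      rw [div_le_iff₀ hn, add_mul, one_div_mul_cancel hn.ne']
      linarith
  · have hn : (0 : ℝ) < n + 1 := by positivity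
    exact (le_div_iff₀ hn).2 (Int.lt_floor_add_one _).le

theorem Cadlag.measurable_comp_max {x : ℝ → ℝ} (hx : Cadlag x) :
    Measurable fun t => x (max t 0) := by
  refine measurable_of_continuousWithinAt_Ici fun t => ?_
  refine ContinuousWithinAt.comp (t := Ici (max t 0)) (hx.1 _ (le_max_right _ _))
    (by fun_prop) fun s hs => ?_
  exact max_le_max_right 0 (mem_Ici.1 hs)

theorem Cadlag.exists_abs_le {x : ℝ → ℝ} (hx : Cadlag x) (T : ℝ) :
    ∃ C, ∀ t ∈ Icc 0 T, |x t| ≤ C := by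
  have of_tendsto : ∀ {l : Filter ℝ} {a : ℝ}, Tendsto x l (𝓝 a) →
      ∀ᶠ s in l, |x s| ≤ |a| + 1 := fun {l a} h =>
    (h.abs.eventually (gt_mem_nhds (lt_add_one |a|))).mono fun _ hs => hs.le
  refine isCompact_Icc.induction_on (p := fun s => ∃ C, ∀ t ∈ s, |x t| ≤ C) ⟨0, by simp⟩
    (fun s t hst ⟨C, hC⟩ => ⟨C, fun r hr => hC r (hst hr)⟩)
    (fun s t ⟨C, hC⟩ ⟨D, hD⟩ => ⟨max C D, fun r hr => ?_⟩) fun t ht => ?_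
  · exact hr.elim (fun h => (hC r h).trans (le_max_left _ _))
      fun h => (hD r h).trans (le_max_right _ _)
  · have hright := of_tendsto (hx.1 t ht.1).tendsto
    rcases ht.1.eq_or_lt with rfl | hpos
    · refine ⟨{s | |x s| ≤ |x 0| + 1}, ?_, |x 0| + 1, fun s hs => hs⟩
      exact nhdsWithin_mono _ Icc_subset_Ici_self hright
    · obtain ⟨l, hl⟩ := hx.2 t hpos
      have hleft := of_tendsto hl
      refine ⟨{s | |x s| ≤ max (|l| + 1) (|x t| + 1)}, mem_nhdsWithin_of_mem_nhds ?_, _,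
        fun s hs => hs⟩
      rw [← nhdsLT_sup_nhdsGE]
      exact mem_sup.2 ⟨hleft.mono fun s hs => hs.trans (le_max_left _ _),
        hright.mono fun s hs => hs.trans (le_max_right _ _)⟩

theorem exists_measure_Icc_lt_one (μ : Measure ℝ) [IsLocallyFiniteMeasure μ] (h0 : μ {0} = 0) :
    ∃ δ > 0, μ (Icc 0 δ) < 1 := by
  have h := tendsto_measure_Icc_nhdsWithin_right' μ 0
  rw [h0] at h
  obtain ⟨δ, hδ, hδ0⟩ :=
    ((h.eventually (gt_mem_nhds zero_lt_one)).and self_mem_nhdsWithin).exists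
  refine ⟨δ, hδ0, (measure_mono (Icc_subset_Icc ?_ (by simp))).trans_lt hδ⟩
  simpa using (mem_Ioi.1 hδ0).le

/-- A nonnegative, locally bounded subsolution of the homogeneous renewal equation vanishes. -/
theorem eq_zero_of_le_renewal_integral (μ : Measure ℝ) [IsLocallyFiniteMeasure μ]
    (h0 : μ {0} = 0) {d : ℝ → ℝ} (hd : ∀ t, 0 ≤ d t)
    (hbdd : ∀ T, ∃ C, ∀ t ∈ Icc 0 T, d t ≤ C)
    (hle : ∀ u, 0 ≤ u → d u ≤ ∫ v in Icc 0 u, d (u - v) ∂μ) :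
    ∀ u, 0 ≤ u → d u = 0 := by
  obtain ⟨δ, hδ, hμδ⟩ := exists_measure_Icc_lt_one μ h0
  set q := μ.real (Icc 0 δ) with hq
  have hq0 : 0 ≤ q := measureReal_nonneg
  have hq1 : q < 1 := by
    simpa [hq, Measure.real] using (ENNReal.toReal_lt_toReal hμδ.ne_top ENNReal.one_ne_top).2 hμδ
  have step : ∀ n : ℕ, ∀ u, 0 ≤ u → u < n * δ → d u = 0 := by
    intro n
    induction n with
    | zero => intro u hu hu'; simp at hu'; linarith
    | succ n ih =>
      obtain ⟨C, hC⟩ := hbdd ((n + 1) * δ)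
      have geom : ∀ m : ℕ, ∀ u, 0 ≤ u → u < (n + 1) * δ → d u ≤ q ^ m * C := by
        intro m
        induction m with
        | zero => intro u hu hu'; simpa using hC u ⟨hu, hu'.le⟩
        | succ m ihm =>
          intro u hu hu'
          have hB : 0 ≤ q ^ m * C := (hd u).trans (ihm u hu hu')
          have hbound : ∀ v ∈ Icc 0 u,
              d (u - v) ≤ (Icc 0 δ).indicator (fun _ => q ^ m * C) v := by
            intro v hv
            by_cases hvδ : v ≤ δ
            · rw [indicator_of_mem (show v ∈ Icc 0 δ from ⟨hv.1, hvδ⟩)]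
              exact ihm _ (by linarith [hv.2]) (by linarith [hv.1])
            · rw [indicator_of_notMem (fun h => hvδ h.2)]
              exact (ih _ (by linarith [hv.2]) (by linarith)).le
          have hint : Integrable ((Icc 0 δ).indicator fun _ => q ^ m * C) μ :=
            (integrable_indicator_iff measurableSet_Icc).2
              (integrableOn_const isCompact_Icc.measure_ne_top)
          calc d u ≤ ∫ v in Icc 0 u, d (u - v) ∂μ := hle u hu
            _ ≤ ∫ v in Icc 0 u, (Icc 0 δ).indicator (fun _ => q ^ m * C) v ∂μ :=
                integral_mono_of_nonneg (Eventually.of_forall fun v => hd _) hint.integrableOn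
                  (ae_restrict_of_forall_mem measurableSet_Icc hbound)
            _ ≤ ∫ v, (Icc 0 δ).indicator (fun _ => q ^ m * C) v ∂μ :=
                setIntegral_le_integral hint
                  (Eventually.of_forall fun v => indicator_nonneg (fun _ _ => hB) v)
            _ = q ^ (m + 1) * C := by
                rw [integral_indicator measurableSet_Icc, setIntegral_const, smul_eq_mul, ← hq]
                ring
      intro u hu hu'
      have hlim : Tendsto (fun m : ℕ => q ^ m * C) atTop (𝓝 0) := by
        simpa using (tendsto_pow_atTop_nhds_zero_of_lt_one hq0 hq1).mul_const C
      refine le_antisymm (ge_of_tendsto' hlim fun m => geom m u hu ?_) (hd u)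
      exact_mod_cast hu'
  intro u hu
  obtain ⟨n, hn⟩ := exists_nat_gt (u / δ)
  exact step n u hu ((div_lt_iff₀ hδ).1 hn)

theorem firstMoment_pos (ν : Measure ℝ) [IsProbabilityMeasure ν] (hneg : ν (Iio 0) = 0)
    (hzero : ν {0} = 0) (hint : Integrable (fun x => x) ν) : 0 < firstMoment ν := by
  have hIic : ν (Iic 0) = 0 := by
    rw [← Iio_union_right]
    exact measure_union_null hneg hzero
  have hpos : ∀ᵐ x ∂ν, 0 < x := by
    simpa [ae_iff, ← Iic_def] using hIic
  refine (integral_pos_iff_support_of_nonneg_ae (hpos.mono fun x hx => hx.le) hint).2 ?_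
  have hsupp : Function.support (fun x : ℝ => x) = {0}ᶜ := by
    ext x; simp
  rw [hsupp, prob_compl_eq_one_sub (measurableSet_singleton 0), hzero]
  simp

theorem eqMeasure_le (ν : Measure ℝ) [IsProbabilityMeasure ν] :
    eqMeasure ν ≤ (ENNReal.ofReal (firstMoment ν))⁻¹ • (volume : Measure ℝ) := by
  have h : (volume.restrict (Ici (0 : ℝ))).withDensity (fun y => ν (Ioi y)) ≤ volume :=
    calc (volume.restrict (Ici (0 : ℝ))).withDensity (fun y => ν (Ioi y))
        ≤ (volume.restrict (Ici (0 : ℝ))).withDensity 1 :=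
          withDensity_mono (Eventually.of_forall fun y => prob_le_one)
      _ = volume.restrict (Ici (0 : ℝ)) := withDensity_one
      _ ≤ volume := Measure.restrict_le_self
  intro s
  simp only [eqMeasure, Measure.smul_apply, smul_eq_mul]
  gcongr

theorem isLocallyFiniteMeasure_eqMeasure (ν : Measure ℝ) [IsProbabilityMeasure ν]
    (hβ : 0 < firstMoment ν) : IsLocallyFiniteMeasure (eqMeasure ν) := by
  refine ⟨fun t => ⟨Icc (t - 1) (t + 1), Icc_mem_nhds (by linarith) (by linarith), ?_⟩⟩
  refine (eqMeasure_le ν _).trans_lt ?_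
  rw [Measure.smul_apply, smul_eq_mul]
  exact ENNReal.mul_lt_top (by simpa using hβ) isCompact_Icc.measure_lt_top

theorem eqMeasure_singleton (ν : Measure ℝ) [IsProbabilityMeasure ν] (t : ℝ) :
    eqMeasure ν {t} = 0 :=
  le_antisymm ((eqMeasure_le ν _).trans (by simp)) zero_le

theorem integrableOn_Icc_comp_sub {μ : Measure ℝ} [IsLocallyFiniteMeasure μ] {f : ℝ → ℝ}
    (hf : Measurable f) {u C : ℝ} (hC : ∀ t ∈ Icc 0 u, |f t| ≤ C) :
    IntegrableOn (fun v => f (u - v)) (Icc 0 u) μ := by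
  refine IntegrableOn.of_bound isCompact_Icc.measure_lt_top
    (hf.comp (measurable_const.sub measurable_id)).aestronglyMeasurable C
    (ae_restrict_of_forall_mem measurableSet_Icc fun v hv => ?_)
  exact hC _ ⟨by linarith [hv.2], by linarith [hv.1]⟩


/-- **Comparison lemma for the renewal-type integral equation**: if `h₁ ≤ h₂` pointwise on
`[0,∞)` with `h₁(0) < h₂(0)`, then the corresponding càdlàg solutions satisfy `x₁ ≤ x₂`. -/
theorem renewal_solution_comparison
    (K : ℝ) (hK : 0 < K)
    (ν : Measure ℝ) [IsProbabilityMeasure ν]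
    (hνsupp : ν (Set.Iio 0) = 0) (hν0 : ν ({0} : Set ℝ) = 0)
    (hνmean : Integrable (fun x => x) ν)
    (h₁ h₂ : ℝ → ℝ)
    (h₁nn : ∀ u : ℝ, 0 ≤ u → 0 ≤ h₁ u) (h₂nn : ∀ u : ℝ, 0 ≤ u → 0 ≤ h₂ u)
    (hle : ∀ u : ℝ, 0 ≤ u → h₁ u ≤ h₂ u) (h0 : h₁ 0 < h₂ 0)
    (x₁ x₂ : ℝ → ℝ) (hc₁ : Cadlag x₁) (hc₂ : Cadlag x₂)
    (he₁ : RenewalEqn K ν h₁ x₁) (he₂ : RenewalEqn K ν h₂ x₂) :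
    ∀ u : ℝ, 0 ≤ u → x₁ u ≤ x₂ u := by
  have hβ := firstMoment_pos ν hνsupp hν0 hνmean
  have := isLocallyFiniteMeasure_eqMeasure ν hβ
  have : IsLocallyFiniteMeasure (ν + eqMeasure ν) := ⟨fun t => by
    obtain ⟨s, hs, hsfin⟩ := (eqMeasure ν).finiteAt_nhds t
    exact ⟨s, hs, by simpa using hsfin⟩⟩
  set y₁ : ℝ → ℝ := fun t => x₁ (max t 0)
  set y₂ : ℝ → ℝ := fun t => x₂ (max t 0)
  have hm₁ : Measurable y₁ := hc₁.measurable_comp_max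
  have hm₂ : Measurable y₂ := hc₂.measurable_comp_max
  have hy₁ : ∀ t, 0 ≤ t → y₁ t = x₁ t := fun t ht => by simp [y₁, ht]
  have hy₂ : ∀ t, 0 ≤ t → y₂ t = x₂ t := fun t ht => by simp [y₂, ht]
  have eqn : ∀ {h x y : ℝ → ℝ}, (∀ t, 0 ≤ t → y t = x t) → RenewalEqn K ν h x →
      RenewalEqn K ν h y := by
    intro h x y hxy hx u hu
    rw [hxy u hu, hx u hu]
    congr 1
    · congr 1
      refine setIntegral_congr_fun measurableSet_Icc fun v hv => ?_
      simp only [hxy (u - v) (by linarith [hv.2])]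
    · refine setIntegral_congr_fun measurableSet_Icc fun v hv => ?_
      simp only [hxy (u - v) (by linarith [hv.2])]
  have hbdd : ∀ T, ∃ C, ∀ t ∈ Icc 0 T, |y₁ t| ≤ C ∧ |y₂ t| ≤ C := by
    intro T
    obtain ⟨C₁, hC₁⟩ := hc₁.exists_abs_le T
    obtain ⟨C₂, hC₂⟩ := hc₂.exists_abs_le T
    refine ⟨max C₁ C₂, fun t ht => ⟨?_, ?_⟩⟩
    · rw [hy₁ t ht.1]; exact (hC₁ t ht).trans (le_max_left _ _)
    · rw [hy₂ t ht.1]; exact (hC₂ t ht).trans (le_max_right _ _)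
  have hzero := eq_zero_of_le_renewal_integral (ν + eqMeasure ν)
    (d := fun t => max (y₁ t - y₂ t) 0) (by simp [hν0, eqMeasure_singleton])
    (fun t => le_max_right _ _) (fun T => ?_) fun u hu => ?_
  · intro u hu
    have := max_eq_right_iff.1 (hzero u hu)
    rw [← hy₁ u hu, ← hy₂ u hu]
    linarith
  · obtain ⟨C, hC⟩ := hbdd T
    refine ⟨C + C, fun t ht => ?_⟩
    obtain ⟨h₁, h₂⟩ := hC t ht
    rw [abs_le] at h₁ h₂
    exact max_le (by linarith) (by linarith)
  · obtain ⟨C, hC⟩ := hbdd u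
    have hmax : ∀ {μ : Measure ℝ} [IsLocallyFiniteMeasure μ] {y : ℝ → ℝ}, Measurable y →
        (∀ t ∈ Icc 0 u, |y t| ≤ C) →
        IntegrableOn (fun v => max (y (u - v) - K) 0) (Icc 0 u) μ := fun hy hyC =>
      ((integrableOn_Icc_comp_sub hy hyC).sub
        (integrableOn_const isCompact_Icc.measure_ne_top)).sup integrableOn_zero
    have hmin : ∀ {μ : Measure ℝ} [IsLocallyFiniteMeasure μ] {y : ℝ → ℝ}, Measurable y →
        (∀ t ∈ Icc 0 u, |y t| ≤ C) →
        IntegrableOn (fun v => min (y (u - v)) K) (Icc 0 u) μ := fun hy hyC =>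
      (integrableOn_Icc_comp_sub hy hyC).inf
        (integrableOn_const isCompact_Icc.measure_ne_top)
    have hd : ∀ {μ : Measure ℝ} [IsLocallyFiniteMeasure μ],
        IntegrableOn (fun v => max (y₁ (u - v) - y₂ (u - v)) 0) (Icc 0 u) μ :=
      ((integrableOn_Icc_comp_sub hm₁ fun t ht => (hC t ht).1).sub
        (integrableOn_Icc_comp_sub hm₂ fun t ht => (hC t ht).2)).sup integrableOn_zero
    have hν : (∫ v in Icc 0 u, max (y₁ (u - v) - K) 0 ∂ν)
        ≤ (∫ v in Icc 0 u, max (y₂ (u - v) - K) 0 ∂ν)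
          + ∫ v in Icc 0 u, max (y₁ (u - v) - y₂ (u - v)) 0 ∂ν := by
      rw [← integral_add (hmax hm₂ fun t ht => (hC t ht).2) hd]
      refine integral_mono (hmax hm₁ fun t ht => (hC t ht).1)
        ((hmax hm₂ fun t ht => (hC t ht).2).add hd) fun v => ?_
      change max (y₁ (u - v) - K) 0
        ≤ max (y₂ (u - v) - K) 0 + max (y₁ (u - v) - y₂ (u - v)) 0
      grind
    have hνe : (∫ v in Icc 0 u, min (y₁ (u - v)) K ∂(eqMeasure ν))
        ≤ (∫ v in Icc 0 u, min (y₂ (u - v)) K ∂(eqMeasure ν))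
          + ∫ v in Icc 0 u, max (y₁ (u - v) - y₂ (u - v)) 0 ∂(eqMeasure ν) := by
      rw [← integral_add (hmin hm₂ fun t ht => (hC t ht).2) hd]
      refine integral_mono (hmin hm₁ fun t ht => (hC t ht).1)
        ((hmin hm₂ fun t ht => (hC t ht).2).add hd) fun v => ?_
      change min (y₁ (u - v)) K
        ≤ min (y₂ (u - v)) K + max (y₁ (u - v) - y₂ (u - v)) 0
      grind
    rw [Measure.restrict_add, integral_add_measure hd hd]
    refine max_le ?_ (add_nonneg (integral_nonneg fun v => le_max_right _ _)
      (integral_nonneg fun v => le_max_right _ _))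
    have e₁ := eqn hy₁ he₁ u hu
    have e₂ := eqn hy₂ he₂ u hu
    linarith [hle u hu]
end

section
/- Let ℋ be a family of nonnegative, nonincreasing functions on [0,∞) such that sup_{h∈ℋ} h(0) < ∞ and lim_{x→∞} sup_{h∈ℋ} ∫ₓ^∞ h(y) dy = 0. Let F be the CDF of a nonlattice probability measure on [0,∞) with finite positive mean β, and let U(x) = ∑_{n=0}^∞ F^{*n}(x) be the associated renewal function, where F^{*n} is the n-fold convolution of F (with F^{*0} the CDF of the point mass at 0). Then lim_{x→∞} sup_{h∈ℋ} | (U*h)(x) − (1/β)∫₀^∞ h(y) dy | = 0, where (U*h)(x) = ∫_{[0,x]} h(x−y) dU(y). -/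
open MeasureTheory Set Filter
open scoped ENNReal NNReal Topology

/-- A measure on `[0,∞)` is nonlattice if it is not concentrated on `{0, δ, 2δ, ...}`
for any `δ > 0`. -/
def Nonlattice (ν : Measure ℝ) : Prop :=
  ∀ δ : ℝ, 0 < δ → ν ({x : ℝ | ∃ n : ℕ, x = n * δ}ᶜ) ≠ 0

/-- The `n`-fold convolution power `μ^{*n}` of a measure on `ℝ` (with `μ^{*0} = δ₀`). -/
noncomputable def convPow (μ : Measure ℝ) : ℕ → Measure ℝ
  | 0 => Measure.dirac 0
  | n + 1 => Measure.map (fun p : ℝ × ℝ => p.1 + p.2) ((convPow μ n).prod μ)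

/-- The renewal measure `dU = ∑_{n≥0} μ^{*n}`, the Lebesgue–Stieltjes measure of the
renewal function `U(x) = ∑_{n≥0} F^{*n}(x)`. -/
noncomputable def renewalMeasure (μ : Measure ℝ) : Measure ℝ :=
  Measure.sum fun n => convPow μ n

instance isProbabilityMeasure_convPow (μ : Measure ℝ) [IsProbabilityMeasure μ] (n : ℕ) :
    IsProbabilityMeasure (convPow μ n) := by
  induction n with
  | zero => exact Measure.dirac.isProbabilityMeasure
  | succ n ih => exact Measure.isProbabilityMeasure_map (by fun_prop)

instance sFinite_renewalMeasure (μ : Measure ℝ) [IsProbabilityMeasure μ] :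
    SFinite (renewalMeasure μ) := by
  unfold renewalMeasure; infer_instance

lemma lintegral_convPow_succ (μ : Measure ℝ) [IsProbabilityMeasure μ] (n : ℕ)
    {f : ℝ → ℝ≥0∞} (hf : Measurable f) :
    ∫⁻ x, f x ∂convPow μ (n + 1) = ∫⁻ x, ∫⁻ y, f (x + y) ∂μ ∂convPow μ n := by
  rw [convPow, lintegral_map hf (by fun_prop), lintegral_prod _ (by fun_prop)]

lemma convPow_succ_Iic (μ : Measure ℝ) [IsProbabilityMeasure μ] (n : ℕ) (t : ℝ) :
    convPow μ (n + 1) (Iic t) = ∫⁻ x, μ (Iic (t - x)) ∂convPow μ n := by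
  rw [← lintegral_indicator_one measurableSet_Iic,
    lintegral_convPow_succ μ n (measurable_one.indicator measurableSet_Iic)]
  refine lintegral_congr fun x => ?_
  rw [← lintegral_indicator_one measurableSet_Iic]
  refine lintegral_congr fun y => ?_
  simp only [indicator, mem_Iic, Pi.one_apply, le_sub_iff_add_le']

lemma convPow_Iio_zero {μ : Measure ℝ} [IsProbabilityMeasure μ] (hsupp : μ (Iio 0) = 0)
    (n : ℕ) : convPow μ n (Iio 0) = 0 := by
  induction n with
  | zero => simp [convPow]
  | succ n ih =>
    have hae : ∀ᵐ x ∂convPow μ n, 0 ≤ x := by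
      rw [ae_iff]; simpa [Iio] using ih
    have hae' : ∀ᵐ x ∂μ, 0 ≤ x := by
      rw [ae_iff]; simpa [Iio] using hsupp
    rw [← lintegral_indicator_one measurableSet_Iio,
      lintegral_convPow_succ μ n (measurable_one.indicator measurableSet_Iio)]
    refine lintegral_eq_zero_of_ae_eq_zero ?_
    filter_upwards [hae] with x hx
    refine lintegral_eq_zero_of_ae_eq_zero ?_
    filter_upwards [hae'] with y hy
    simp [indicator, add_nonneg hx hy]

lemma renewalMeasure_Iio_zero {μ : Measure ℝ} [IsProbabilityMeasure μ] (hsupp : μ (Iio 0) = 0) :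
    renewalMeasure μ (Iio 0) = 0 := by
  simp [renewalMeasure, Measure.sum_apply, convPow_Iio_zero hsupp]

lemma lintegral_renewalMeasure_eq (μ : Measure ℝ) [IsProbabilityMeasure μ]
    {f : ℝ → ℝ≥0∞} (hf : Measurable f) :
    ∫⁻ x, f x ∂renewalMeasure μ = f 0 + ∫⁻ y, ∫⁻ x, f (x + y) ∂renewalMeasure μ ∂μ := by
  have h : ∫⁻ y, ∫⁻ x, f (x + y) ∂renewalMeasure μ ∂μ
      = ∑' n, ∫⁻ x, f x ∂convPow μ (n + 1) := by
    rw [lintegral_lintegral_swap (f := fun y x => f (x + y)) (by fun_prop)]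
    simp_rw [renewalMeasure, lintegral_sum_measure, lintegral_convPow_succ μ _ hf]
  rw [h, renewalMeasure, lintegral_sum_measure, tsum_eq_zero_add' ENNReal.summable]
  simp [convPow, lintegral_dirac' _ hf]

/-- The survival function `y ↦ μ (y, ∞)`, extended by `0` to the negative half-line. -/
noncomputable def survival (μ : Measure ℝ) : ℝ → ℝ≥0∞ :=
  (Ici 0).indicator fun y => μ (Ioi y)

lemma antitone_measure_Ioi (μ : Measure ℝ) : Antitone fun y : ℝ => μ (Ioi y) :=
  fun _ _ h => measure_mono (Ioi_subset_Ioi h)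

lemma measurable_survival (μ : Measure ℝ) : Measurable (survival μ) :=
  (antitone_measure_Ioi μ).measurable.indicator measurableSet_Ici

lemma convPow_Iic_eq_add {μ : Measure ℝ} [IsProbabilityMeasure μ] (hsupp : μ (Iio 0) = 0)
    (n : ℕ) (t : ℝ) :
    convPow μ n (Iic t) =
      convPow μ (n + 1) (Iic t) + ∫⁻ x, survival μ (t - x) ∂convPow μ n := by
  have hm : Measurable fun x => survival μ (t - x) :=
    (measurable_survival μ).comp (by fun_prop)
  rw [convPow_succ_Iic, ← lintegral_add_right _ hm, ← lintegral_indicator_one measurableSet_Iic]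
  refine lintegral_congr fun x => ?_
  by_cases hx : x ≤ t
  · have h1 := measure_add_measure_compl (μ := μ) (measurableSet_Iic (a := t - x))
    rw [compl_Iic, measure_univ] at h1
    simp [survival, indicator, hx, h1]
  · have h1 : μ (Iic (t - x)) = 0 :=
      measure_mono_null (fun y hy => by simp only [mem_Iic, mem_Iio] at *; linarith) hsupp
    simp [survival, indicator, hx, h1]

lemma one_eq_convPow_add_sum {μ : Measure ℝ} [IsProbabilityMeasure μ] (hsupp : μ (Iio 0) = 0)
    (N : ℕ) {t : ℝ} (ht : 0 ≤ t) :
    1 = convPow μ N (Iic t) +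
      ∑ n ∈ Finset.range N, ∫⁻ x, survival μ (t - x) ∂convPow μ n := by
  induction N with
  | zero => simp [convPow, ht]
  | succ N ih =>
    rw [Finset.sum_range_succ, ih, convPow_Iic_eq_add hsupp N t]
    ring

lemma lintegral_survival_le_one {μ : Measure ℝ} [IsProbabilityMeasure μ]
    (hsupp : μ (Iio 0) = 0) {t : ℝ} (ht : 0 ≤ t) :
    ∫⁻ x, survival μ (t - x) ∂renewalMeasure μ ≤ 1 := by
  rw [renewalMeasure, lintegral_sum_measure]
  refine ENNReal.tsum_le_of_sum_range_le fun N => ?_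
  conv_rhs => rw [one_eq_convPow_add_sum hsupp N ht]
  exact le_add_self

lemma exists_pos_measure_Ioi {μ : Measure ℝ} (hβ : 0 < firstMoment μ) :
    ∃ a > 0, μ (Ioi a) ≠ 0 := by
  by_contra! h
  have h0 : μ (Ioi 0) = 0 := by
    have : Ioi (0:ℝ) = ⋃ n : ℕ, Ioi (1 / ((n : ℝ) + 1)) := by
      ext x
      simp only [mem_Ioi, mem_iUnion]
      exact ⟨fun hx => exists_nat_one_div_lt hx, fun ⟨n, hn⟩ => lt_trans (by positivity) hn⟩
    rw [this, measure_iUnion_null_iff]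
    exact fun n => h _ (by positivity)
  refine absurd hβ (not_lt.mpr (integral_nonpos_of_ae ?_))
  filter_upwards [measure_eq_zero_iff_ae_notMem.mp h0] with x hx
  simpa using hx

lemma renewalMeasure_Icc_le {μ : Measure ℝ} [IsProbabilityMeasure μ]
    (hsupp : μ (Iio 0) = 0) (a t : ℝ) :
    renewalMeasure μ (Icc (t - a) t) ≤ (μ (Ioi a))⁻¹ := by
  rcases lt_or_ge t 0 with ht | ht
  · rw [measure_mono_null (fun x hx => lt_of_le_of_lt hx.2 ht) (renewalMeasure_Iio_zero hsupp)]
    exact zero_le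
  · rw [ENNReal.le_inv_iff_mul_le]
    refine le_trans ?_ (lintegral_survival_le_one hsupp ht)
    rw [mul_comm, ← lintegral_indicator_const measurableSet_Icc]
    refine lintegral_mono fun x => ?_
    refine indicator_le (g := fun x => survival μ (t - x)) (fun x hx => ?_) x
    rw [survival, indicator_of_mem (by simpa using hx.2)]
    exact measure_mono (Ioi_subset_Ioi (by linarith [hx.1]))

lemma exists_renewalMeasure_Icc_le {μ : Measure ℝ} [IsProbabilityMeasure μ]
    (hsupp : μ (Iio 0) = 0) (hβ : 0 < firstMoment μ) (L : ℝ) :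
    ∃ C : ℝ≥0∞, C ≠ ∞ ∧ ∀ x, renewalMeasure μ (Icc x (x + L)) ≤ C := by
  obtain ⟨a, ha, hμ⟩ := exists_pos_measure_Ioi hβ
  have key : ∀ N : ℕ, ∀ x,
      renewalMeasure μ (Icc x (x + N * a)) ≤ (N + 1) * (μ (Ioi a))⁻¹ := by
    intro N x
    induction N with
    | zero =>
      refine le_trans (measure_mono ?_) ((renewalMeasure_Icc_le hsupp a x).trans (by simp))
      exact Icc_subset_Icc (by linarith) (by simp)
    | succ N ih =>
      have hsub : Icc x (x + (N + 1 : ℕ) * a) ⊆ Icc x (x + N * a) ∪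
          Icc (x + (N + 1 : ℕ) * a - a) (x + (N + 1 : ℕ) * a) := by
        intro y hy
        rcases le_total y (x + N * a) with h | h
        · exact Or.inl ⟨hy.1, h⟩
        · refine Or.inr ⟨?_, hy.2⟩
          push_cast
          linarith
      refine (measure_mono hsub).trans ((measure_union_le _ _).trans ?_)
      refine (add_le_add ih (renewalMeasure_Icc_le hsupp a _)).trans (le_of_eq ?_)
      push_cast
      ring
  obtain ⟨N, hN⟩ := exists_nat_ge (L / a)
  refine ⟨(N + 1) * (μ (Ioi a))⁻¹, ?_, fun x => le_trans (measure_mono ?_) (key N x)⟩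
  · exact ENNReal.mul_ne_top (by simp) (ENNReal.inv_ne_top.mpr hμ)
  · rw [div_le_iff₀ ha] at hN
    exact Icc_subset_Icc le_rfl (by linarith)

lemma lintegral_survival_eq_one {μ : Measure ℝ} [IsProbabilityMeasure μ]
    (hsupp : μ (Iio 0) = 0) (hβ : 0 < firstMoment μ) {t : ℝ} (ht : 0 ≤ t) :
    ∫⁻ x, survival μ (t - x) ∂renewalMeasure μ = 1 := by
  obtain ⟨C, hC, hU⟩ := exists_renewalMeasure_Icc_le hsupp hβ t
  have hfin : ∑' n, convPow μ n (Iic t) ≠ ∞ := by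
    rw [← Measure.sum_apply _ measurableSet_Iic]
    refine ne_top_of_le_ne_top hC (le_trans ?_ (hU 0))
    have hsub : Iic t ⊆ Iio 0 ∪ Icc 0 (0 + t) := fun x hx => by
      rcases lt_or_ge x 0 with h | h
      · exact Or.inl h
      · exact Or.inr ⟨h, by simpa using hx⟩
    refine (measure_mono hsub).trans ((measure_union_le _ _).trans ?_)
    change renewalMeasure μ _ + renewalMeasure μ _ ≤ _
    rw [renewalMeasure_Iio_zero hsupp, zero_add]
  have h0 := ENNReal.tendsto_atTop_zero_of_tsum_ne_top hfin
  have h1 := ENNReal.tendsto_nat_tsum fun n => ∫⁻ x, survival μ (t - x) ∂convPow μ n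
  have h2 := h0.add h1
  simp_rw [← one_eq_convPow_add_sum hsupp _ ht, zero_add] at h2
  rw [renewalMeasure, lintegral_sum_measure]
  exact tendsto_nhds_unique h2 tendsto_const_nhds |>.symm ▸ rfl

lemma lintegral_survival {μ : Measure ℝ} (hsupp : μ (Iio 0) = 0)
    (hmean : Integrable (fun x => x) μ) :
    ∫⁻ y, survival μ y = ENNReal.ofReal (firstMoment μ) := by
  have hae : 0 ≤ᵐ[μ] fun x : ℝ => x := by
    filter_upwards [measure_eq_zero_iff_ae_notMem.mp hsupp] with x hx
    simpa using hx
  rw [firstMoment, ofReal_integral_eq_lintegral_ofReal hmean hae,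
    lintegral_eq_lintegral_meas_lt μ hae hmean.aemeasurable, survival,
    lintegral_indicator measurableSet_Ici, setLIntegral_congr Ioi_ae_eq_Ici.symm]
  rfl

lemma lintegral_mul_lintegral_sub (ν : Measure ℝ) [SFinite ν] {f κ : ℝ → ℝ≥0∞}
    (hf : Measurable f) (hκ : Measurable κ) (t : ℝ) :
    ∫⁻ r, f r * ∫⁻ y, κ (t - r - y) ∂ν = ∫⁻ y, (∫⁻ s, κ s * f (t - y - s)) ∂ν := by
  calc ∫⁻ r, f r * ∫⁻ y, κ (t - r - y) ∂ν
      = ∫⁻ r, ∫⁻ y, f r * κ (t - r - y) ∂ν := by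
        refine lintegral_congr fun r => ?_
        rw [lintegral_const_mul _ (by fun_prop)]
    _ = ∫⁻ y, (∫⁻ r, f r * κ (t - r - y)) ∂ν := lintegral_lintegral_swap (by fun_prop)
    _ = _ := by
        refine lintegral_congr fun y => ?_
        rw [← lintegral_sub_left_eq_self _ (t - y)]
        refine lintegral_congr fun s => ?_
        rw [mul_comm]
        congr 2
        ring

lemma lintegral_mul_lintegral_sub' (ν : Measure ℝ) [SFinite ν] {f κ : ℝ → ℝ≥0∞}
    (hf : Measurable f) (hκ : Measurable κ) (t : ℝ) :
    ∫⁻ r, f r * ∫⁻ y, κ (t - r - y) ∂ν = ∫⁻ s, κ s * ∫⁻ y, f (t - s - y) ∂ν := by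
  rw [lintegral_mul_lintegral_sub ν hf hκ, lintegral_lintegral_swap (by fun_prop)]
  refine lintegral_congr fun s => ?_
  rw [lintegral_const_mul _ (by fun_prop)]
  simp_rw [sub_right_comm t _ s]

/-- If a bounded function `D` satisfies `D t = ∫ D (t - y) dμ y` for large `t` and converges to an
asymptotic upper bound along `l`, then it also does along the shift of `l` by any point of the
support of `μ`. -/
lemma tendsto_sub_of_mem_support {μ : Measure ℝ} [IsProbabilityMeasure μ] {D : ℝ → ℝ}
    (hD : UniformContinuous D) {K : ℝ} (hK : ∀ t, |D t| ≤ K)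
    (hren : ∀ᶠ t in atTop, D t = ∫ y, D (t - y) ∂μ) {η : ℝ}
    (hη : ∀ ε > 0, ∀ᶠ t in atTop, D t < η + ε) {a : ℝ} (ha : a ∈ μ.support)
    {ι : Type*} {l : Filter ι} [l.IsCountablyGenerated] {s : ι → ℝ}
    (hs : Tendsto s l atTop) (hDs : Tendsto (fun i => D (s i)) l (𝓝 η)) :
    Tendsto (fun i => D (s i - a)) l (𝓝 η) := by
  have hDc := hD.continuous
  have hDi : ∀ t, Integrable (fun y => D (t - y)) μ := fun t =>
    Integrable.of_bound (by fun_prop) K (ae_of_all _ fun y => hK _)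
  -- the positive part of `D (s i - y) - η` tends to zero in mean
  have hpos : Tendsto (fun i => ∫ y, max (D (s i - y) - η) 0 ∂μ) l (𝓝 0) := by
    have h0 : ∫ _, (0:ℝ) ∂μ = 0 := integral_zero ℝ ℝ
    nth_rw 2 [← h0]
    refine tendsto_integral_filter_of_dominated_convergence (fun _ => K + |η|) ?_ ?_ ?_ ?_
    · exact Eventually.of_forall fun i => by fun_prop
    · refine Eventually.of_forall fun i => ae_of_all _ fun y => ?_
      rw [Real.norm_eq_abs, abs_of_nonneg (le_max_right _ _)]
      have h1 := abs_le.mp (hK (s i - y))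
      have h2 := neg_abs_le η
      have h3 := abs_nonneg η
      exact max_le (by linarith) (by linarith)
    · exact integrable_const _
    · refine ae_of_all _ fun y => ?_
      rw [Metric.tendsto_nhds]
      intro ε hε
      have hy : Tendsto (fun i => s i - y) l atTop := tendsto_atTop_add_const_right _ _ hs
      filter_upwards [hy.eventually (hη ε hε)] with i hi
      rw [Real.dist_eq, sub_zero, abs_of_nonneg (le_max_right _ _)]
      exact max_lt (by linarith) hε
  have habs : Tendsto (fun i => ∫ y, |D (s i - y) - η| ∂μ) l (𝓝 0) := by
    have h := (hpos.const_mul 2).sub (hDs.sub_const η)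
    simp only [mul_zero, sub_self] at h
    refine h.congr' ?_
    filter_upwards [hs.eventually hren] with i hi
    have hint : Integrable (fun y => D (s i - y) - η) μ := (hDi _).sub (integrable_const _)
    rw [hi, show (∫ y, D (s i - y) ∂μ) - η = ∫ y, (D (s i - y) - η) ∂μ by
      rw [integral_sub (hDi _) (integrable_const _)]; simp]
    rw [← integral_const_mul, ← integral_sub (hint.pos_part.const_mul 2) hint]
    refine integral_congr_ae (ae_of_all _ fun y => ?_)
    simp only
    rcases le_total 0 (D (s i - y) - η) with h0 | h0
    · rw [max_eq_left h0, abs_of_nonneg h0]; ring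
    · rw [max_eq_right h0, abs_of_nonpos h0]; ring
  rw [Metric.tendsto_nhds]
  intro ε hε
  obtain ⟨δ, hδ, hδD⟩ := Metric.uniformContinuous_iff.mp hD (ε / 2) (half_pos hε)
  have hp : 0 < μ.real (Metric.ball a δ) := by
    refine ENNReal.toReal_pos ?_ (measure_ne_top _ _)
    exact ((Measure.mem_support_iff_forall a).mp ha _ (Metric.ball_mem_nhds a hδ)).ne'
  filter_upwards [habs.eventually_lt_const (mul_pos hp (half_pos hε))] with i hi
  rw [Real.dist_eq]
  by_contra! hcon
  refine absurd hi (not_lt.mpr ?_)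
  have hint : Integrable (fun y => |D (s i - y) - η|) μ :=
    ((hDi _).sub (integrable_const _)).abs
  calc μ.real (Metric.ball a δ) * (ε / 2)
      = ∫ y in Metric.ball a δ, ε / 2 ∂μ := by simp
    _ ≤ ∫ y in Metric.ball a δ, |D (s i - y) - η| ∂μ := by
        refine setIntegral_mono_on (integrable_const _) hint.integrableOn measurableSet_ball ?_
        intro y hy
        have h1 : dist (s i - y) (s i - a) < δ := by
          rw [dist_sub_left]; exact hy
        have h2 := hδD h1
        rw [Real.dist_eq] at h2
        have h3 := abs_sub_abs_le_abs_sub (D (s i - a) - η) (D (s i - y) - η)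
        rw [show D (s i - a) - η - (D (s i - y) - η) = -(D (s i - y) - D (s i - a)) by ring,
          abs_neg] at h3
        linarith
    _ ≤ ∫ y, |D (s i - y) - η| ∂μ :=
        setIntegral_le_integral hint (ae_of_all _ fun y => abs_nonneg _)

/-- A bounded uniformly continuous solution `Z` of the renewal equation near infinity has
asymptotically nonpositive increments along points of the support. -/
lemma eventually_increment_lt {μ : Measure ℝ} [IsProbabilityMeasure μ] {Z : ℝ → ℝ}
    (hZ : UniformContinuous Z) {K : ℝ} (hK : ∀ t, |Z t| ≤ K)
    (hren : ∀ᶠ t in atTop, Z t = ∫ y, Z (t - y) ∂μ) {a : ℝ} (ha : a ∈ μ.support) :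
    ∀ ε > 0, ∀ᶠ t in atTop, Z (t + a) - Z t < ε := by
  set D : ℝ → ℝ := fun t => Z (t + a) - Z t with hDdef
  have hDu : UniformContinuous D :=
    (hZ.comp (uniformContinuous_id.add uniformContinuous_const)).sub hZ
  have hDK : ∀ t, |D t| ≤ 2 * K := fun t => by
    have h1 := abs_sub (Z (t + a)) (Z t)
    linarith [hK (t + a), hK t]
  have hZc := hZ.continuous
  have hZi : ∀ t, Integrable (fun y => Z (t - y)) μ := fun t =>
    Integrable.of_bound (by fun_prop) K (ae_of_all _ fun y => hK _)
  have hDren : ∀ᶠ t in atTop, D t = ∫ y, D (t - y) ∂μ := by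
    have ht : Tendsto (fun t : ℝ => t + a) atTop atTop :=
      tendsto_atTop_add_const_right _ _ tendsto_id
    filter_upwards [hren, ht.eventually hren] with t h1 h2
    simp only [hDdef]
    have h3 : ∀ y, t - y + a = t + a - y := fun y => by ring
    simp_rw [h3]
    rw [integral_sub (hZi _) (hZi _), ← h1, ← h2]
  have hbdd : IsBoundedUnder (· ≤ ·) atTop D :=
    isBoundedUnder_of ⟨2 * K, fun t => (abs_le.mp (hDK t)).2⟩
  have hcobdd : IsCoboundedUnder (· ≤ ·) atTop D :=
    IsBoundedUnder.isCoboundedUnder_le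
      (isBoundedUnder_of ⟨-(2 * K), fun t => (abs_le.mp (hDK t)).1⟩)
  set η := limsup D atTop
  have hη : ∀ ε > 0, ∀ᶠ t in atTop, D t < η + ε := fun ε hε =>
    eventually_lt_of_limsup_lt (by linarith) hbdd
  suffices hη0 : η ≤ 0 by
    intro ε hε
    filter_upwards [hη ε hε] with t ht
    simp only [hDdef] at ht ⊢
    linarith
  set l : Filter ℝ := atTop ⊓ comap D (𝓝 η) with hl
  have hne : l.NeBot := by
    rw [hl, inf_neBot_iff_frequently_left]
    intro p hp
    rw [frequently_iff]
    intro V hV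
    obtain ⟨W, hW, hWV⟩ := mem_comap.mp hV
    obtain ⟨ε, hε, hεW⟩ := Metric.mem_nhds_iff.mp hW
    have hf : ∃ᶠ t in atTop, η - ε < D t := frequently_lt_of_lt_limsup hcobdd (by linarith)
    obtain ⟨t, h1, h2, h3⟩ := (hf.and_eventually ((hη ε hε).and hp)).exists
    refine ⟨t, hWV (hεW ?_), h3⟩
    rw [Metric.mem_ball, Real.dist_eq, abs_lt]
    constructor <;> linarith
  have hs : Tendsto (fun t : ℝ => t) l atTop := inf_le_left
  have hDl : Tendsto D l (𝓝 η) := tendsto_comap.mono_left inf_le_right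
  have hshift : ∀ j : ℕ, Tendsto (fun t : ℝ => D (t - j * a)) l (𝓝 η) := by
    intro j
    induction j with
    | zero => simpa using hDl
    | succ j ih =>
      have hj : Tendsto (fun t : ℝ => t - j * a) l atTop := tendsto_atTop_add_const_right _ _ hs
      refine (tendsto_sub_of_mem_support hDu hDK hDren hη ha hj ih).congr fun t => ?_
      congr 1
      push_cast
      ring
  have hsum : ∀ k : ℕ, (k : ℝ) * η ≤ 2 * K := by
    intro k
    have h1 : Tendsto (fun t : ℝ => ∑ j ∈ Finset.range k, D (t - j * a)) l
        (𝓝 (∑ _j ∈ Finset.range k, η)) := tendsto_finsetSum _ fun j _ => hshift j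
    rw [Finset.sum_const, Finset.card_range, nsmul_eq_mul] at h1
    refine le_of_tendsto h1 (Eventually.of_forall fun t => ?_)
    have h2 : ∀ j ∈ Finset.range k,
        D (t - j * a) = -Z (t + a - ((j + 1 : ℕ) : ℝ) * a) - -Z (t + a - (j : ℝ) * a) := by
      intro j _
      simp only [hDdef]
      rw [show t - j * a + a = t + a - j * a by ring,
        show t + a - ((j + 1 : ℕ) : ℝ) * a = t - j * a by push_cast; ring]
      ring
    rw [Finset.sum_congr rfl h2,
      Finset.sum_range_sub (fun j : ℕ => -Z (t + a - (j : ℝ) * a))]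
    have h3 := abs_le.mp (hK (t + a - (k : ℝ) * a))
    have h4 := abs_le.mp (hK (t + a - ((0 : ℕ) : ℝ) * a))
    linarith
  by_contra! hpos
  obtain ⟨k, hk⟩ := exists_nat_gt (2 * K / η)
  rw [div_lt_iff₀ hpos] at hk
  linarith [hsum k]

lemma tendsto_increment_of_mem_support {μ : Measure ℝ} [IsProbabilityMeasure μ] {Z : ℝ → ℝ}
    (hZ : UniformContinuous Z) {K : ℝ} (hK : ∀ t, |Z t| ≤ K)
    (hren : ∀ᶠ t in atTop, Z t = ∫ y, Z (t - y) ∂μ) {a : ℝ} (ha : a ∈ μ.support) :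
    Tendsto (fun t => Z (t + a) - Z t) atTop (𝓝 0) := by
  have h1 := eventually_increment_lt hZ hK hren ha
  have h2 := eventually_increment_lt (Z := fun t => -Z t) hZ.neg (K := K) (by simpa using hK)
    (by filter_upwards [hren] with t ht; rw [integral_neg, ← ht]) ha
  rw [Metric.tendsto_nhds]
  intro ε hε
  filter_upwards [h1 ε hε, h2 ε hε] with t h3 h4
  rw [Real.dist_eq, sub_zero, abs_lt]
  constructor <;> linarith

/-- The additive subgroup of asymptotic periods of `Z`. -/
def asymptoticPeriods (Z : ℝ → ℝ) : AddSubgroup ℝ where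
  carrier := {a | Tendsto (fun t => Z (t + a) - Z t) atTop (𝓝 0)}
  zero_mem' := by simp
  add_mem' {a b} ha hb := by
    have h := (ha.comp (tendsto_atTop_add_const_right _ b tendsto_id)).add hb
    rw [add_zero] at h
    refine h.congr fun t => ?_
    simp only [Function.comp, id]
    rw [show t + b + a = t + (a + b) by ring]
    ring
  neg_mem' {a} ha := by
    have h := (ha.comp (tendsto_atTop_add_const_right _ (-a) tendsto_id)).neg
    rw [neg_zero] at h
    refine h.congr fun t => ?_
    simp only [Function.comp, id]
    rw [neg_add_cancel_right]
    ring

lemma isClosed_asymptoticPeriods {Z : ℝ → ℝ} (hZ : UniformContinuous Z) :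
    IsClosed (asymptoticPeriods Z : Set ℝ) := by
  rw [← closure_subset_iff_isClosed]
  intro a ha
  change Tendsto (fun t => Z (t + a) - Z t) atTop (𝓝 0)
  rw [Metric.tendsto_nhds]
  intro ε hε
  obtain ⟨δ, hδ, hδZ⟩ := Metric.uniformContinuous_iff.mp hZ (ε / 2) (half_pos hε)
  obtain ⟨b, hb, hab⟩ := Metric.mem_closure_iff.mp ha δ hδ
  have hb' : Tendsto (fun t => Z (t + b) - Z t) atTop (𝓝 0) := hb
  filter_upwards [Metric.tendsto_nhds.mp hb' (ε / 2) (half_pos hε)] with t ht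
  have h1 := hδZ (a := t + a) (b := t + b) (by rwa [dist_add_left])
  rw [Real.dist_eq] at *
  rw [sub_zero] at *
  rw [show Z (t + a) - Z t = (Z (t + a) - Z (t + b)) + (Z (t + b) - Z t) by ring]
  exact (abs_add_le _ _).trans_lt (by linarith)

lemma Nonlattice.dense_of_support_subset {μ : Measure ℝ} (hnl : Nonlattice μ)
    (hsupp : μ (Iio 0) = 0) {G : AddSubgroup ℝ} (hG : μ.support ⊆ G) : Dense (G : Set ℝ) := by
  refine (AddSubgroup.dense_or_cyclic G).resolve_right ?_
  rintro ⟨g, rfl⟩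
  have hnull : ∀ δ : ℝ, (δ = |g| ∨ g = 0) →
      μ ({x : ℝ | ∃ n : ℕ, x = n * δ}ᶜ) = 0 := by
    intro δ hδ
    refine measure_mono_null (t := Iio 0 ∪ μ.supportᶜ) (fun x hx => ?_)
      (measure_union_null hsupp Measure.measure_compl_support)
    by_contra hx'
    simp only [mem_union, mem_Iio, mem_compl_iff, not_or, not_lt, not_not] at hx'
    obtain ⟨hx0, hxs⟩ := hx'
    refine hx ?_
    obtain ⟨n, hn⟩ := AddSubgroup.mem_closure_singleton.mp (hG hxs)
    rw [zsmul_eq_mul] at hn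
    rcases hδ with rfl | rfl
    · refine ⟨n.natAbs, ?_⟩
      rw [← abs_of_nonneg hx0, ← hn, abs_mul, Nat.cast_natAbs, Int.cast_abs]
    · exact ⟨0, by simp [← hn]⟩
  by_cases hg : g = 0
  · exact hnl 1 one_pos (hnull 1 (Or.inr hg))
  · exact hnl |g| (abs_pos.mpr hg) (hnull |g| (Or.inl rfl))

/-- Asymptotic Choquet–Deny theorem: a bounded uniformly continuous function solving the renewal
equation near infinity has vanishing increments at infinity. -/
lemma tendsto_increment {μ : Measure ℝ} [IsProbabilityMeasure μ] (hnl : Nonlattice μ)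
    (hsupp : μ (Iio 0) = 0) {Z : ℝ → ℝ}
    (hZ : UniformContinuous Z) {K : ℝ} (hK : ∀ t, |Z t| ≤ K)
    (hren : ∀ᶠ t in atTop, Z t = ∫ y, Z (t - y) ∂μ) (a : ℝ) :
    Tendsto (fun t => Z (t + a) - Z t) atTop (𝓝 0) := by
  have hd : Dense (asymptoticPeriods Z : Set ℝ) :=
    hnl.dense_of_support_subset hsupp fun b hb => tendsto_increment_of_mem_support hZ hK hren hb
  have : a ∈ (asymptoticPeriods Z : Set ℝ) := by
    rw [← (isClosed_asymptoticPeriods hZ).closure_eq, hd.closure_eq]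
    trivial
  exact this

/-- The convolution of a kernel `k` with the renewal measure. -/
noncomputable def renewalConv (μ : Measure ℝ) (k : ℝ → ℝ) (t : ℝ) : ℝ≥0∞ :=
  ∫⁻ y, ENNReal.ofReal (k (t - y)) ∂renewalMeasure μ

/-- A continuous probability density supported in `[-δ, δ]`. -/
structure IsMollifier (k : ℝ → ℝ) (δ : ℝ) : Prop where
  continuous : Continuous k
  nonneg : ∀ s, 0 ≤ k s
  eq_zero : ∀ s, δ < |s| → k s = 0
  lintegral_eq_one : ∫⁻ s, ENNReal.ofReal (k s) = 1

lemma exists_isMollifier {δ : ℝ} (hδ : 0 < δ) : ∃ k, IsMollifier k δ := by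
  let φ : ContDiffBump (0 : ℝ) := ⟨δ / 2, δ, half_pos hδ, half_lt_self hδ⟩
  refine ⟨φ.normed volume, φ.continuous_normed, φ.nonneg_normed, fun s hs => ?_, ?_⟩
  · rw [← Function.notMem_support, φ.support_normed_eq]
    simpa using hs.le
  · rw [← ofReal_integral_eq_lintegral_ofReal φ.integrable_normed
      (ae_of_all _ φ.nonneg_normed), φ.integral_normed, ENNReal.ofReal_one]

namespace IsMollifier

variable {k : ℝ → ℝ} {δ : ℝ}

lemma hasCompactSupport (hk : IsMollifier k δ) : HasCompactSupport k := by
  refine HasCompactSupport.intro (isCompact_Icc (a := -δ) (b := δ)) fun s hs => ?_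
  refine hk.eq_zero s ?_
  by_contra! h
  exact hs (abs_le.mp h)

lemma uniformContinuous (hk : IsMollifier k δ) : UniformContinuous k :=
  hk.hasCompactSupport.uniformContinuous_of_continuous hk.continuous

lemma measurable_ofReal (hk : IsMollifier k δ) : Measurable fun s => ENNReal.ofReal (k s) :=
  hk.continuous.measurable.ennreal_ofReal

lemma mem_Icc_of_ne_zero (hk : IsMollifier k δ) {t y : ℝ} (h : k (t - y) ≠ 0) :
    y ∈ Icc (t - δ) (t - δ + 2 * δ) := by
  have h1 : |t - y| ≤ δ := by
    by_contra! h'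
    exact h (hk.eq_zero _ h')
  obtain ⟨h2, h3⟩ := abs_le.mp h1
  constructor <;> linarith

variable {μ : Measure ℝ}

lemma renewalConv_le_add (hk : IsMollifier k δ) {C : ℝ≥0∞}
    (hC : ∀ x, renewalMeasure μ (Icc x (x + 2 * δ)) ≤ C) {t t' ε : ℝ}
    (h : ∀ y, k (t - y) ≤ k (t' - y) + ε) :
    renewalConv μ k t ≤ renewalConv μ k t' + ENNReal.ofReal ε * C := by
  calc renewalConv μ k t
      ≤ ∫⁻ y, (ENNReal.ofReal (k (t' - y)) +
          (Icc (t - δ) (t - δ + 2 * δ)).indicator (fun _ => ENNReal.ofReal ε) y)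
            ∂renewalMeasure μ := by
        refine lintegral_mono fun y => ?_
        by_cases h0 : k (t - y) = 0
        · simp [h0]
        · rw [indicator_of_mem (hk.mem_Icc_of_ne_zero h0)]
          exact (ENNReal.ofReal_le_ofReal (h y)).trans ENNReal.ofReal_add_le
    _ = renewalConv μ k t' +
          ENNReal.ofReal ε * renewalMeasure μ (Icc (t - δ) (t - δ + 2 * δ)) := by
        rw [lintegral_add_right _ (measurable_const.indicator measurableSet_Icc),
          lintegral_indicator_const measurableSet_Icc]
        rfl
    _ ≤ _ := by gcongr; exact hC _

variable [IsProbabilityMeasure μ]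

lemma measurable_renewalConv (hk : IsMollifier k δ) : Measurable (renewalConv μ k) := by
  have := hk.continuous.measurable
  unfold renewalConv
  fun_prop

lemma exists_renewalConv_le (hk : IsMollifier k δ) (hsupp : μ (Iio 0) = 0)
    (hβ : 0 < firstMoment μ) : ∃ K : ℝ, 0 ≤ K ∧ ∀ t, renewalConv μ k t ≤ ENNReal.ofReal K := by
  obtain ⟨C, hCtop, hC⟩ := exists_renewalMeasure_Icc_le hsupp hβ (2 * δ)
  obtain ⟨B, hB⟩ := hk.hasCompactSupport.exists_bound_of_continuous hk.continuous
  have hle : ∀ t, renewalConv μ k t ≤ ENNReal.ofReal B * C := by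
    intro t
    calc renewalConv μ k t
        ≤ ∫⁻ y, (Icc (t - δ) (t - δ + 2 * δ)).indicator (fun _ => ENNReal.ofReal B) y
            ∂renewalMeasure μ := by
          refine lintegral_mono fun y => ?_
          by_cases h0 : k (t - y) = 0
          · simp [h0]
          · rw [indicator_of_mem (hk.mem_Icc_of_ne_zero h0)]
            exact ENNReal.ofReal_le_ofReal ((le_abs_self _).trans (hB _))
      _ = ENNReal.ofReal B * renewalMeasure μ (Icc (t - δ) (t - δ + 2 * δ)) :=
          lintegral_indicator_const measurableSet_Icc _
      _ ≤ _ := by gcongr; exact hC _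
  refine ⟨(ENNReal.ofReal B * C).toReal, ENNReal.toReal_nonneg, fun t => ?_⟩
  rw [ENNReal.ofReal_toReal (ENNReal.mul_ne_top ENNReal.ofReal_ne_top hCtop)]
  exact hle t

lemma renewalConv_ne_top (hk : IsMollifier k δ) (hsupp : μ (Iio 0) = 0)
    (hβ : 0 < firstMoment μ) (t : ℝ) : renewalConv μ k t ≠ ∞ := by
  obtain ⟨K, -, hK⟩ := hk.exists_renewalConv_le hsupp hβ
  exact ne_top_of_le_ne_top ENNReal.ofReal_ne_top (hK t)

lemma uniformContinuous_renewalConv (hk : IsMollifier k δ) (hsupp : μ (Iio 0) = 0)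
    (hβ : 0 < firstMoment μ) : UniformContinuous fun t => (renewalConv μ k t).toReal := by
  obtain ⟨C, hCtop, hC⟩ := exists_renewalMeasure_Icc_le hsupp hβ (2 * δ)
  rw [Metric.uniformContinuous_iff]
  intro ε hε
  have hC0 := C.toReal_nonneg
  set ε' := ε / (2 * (C.toReal + 1)) with hε'
  have hε'0 : 0 < ε' := by positivity
  have hε'C : ε' * C.toReal < ε := by
    rw [hε', div_mul_eq_mul_div, div_lt_iff₀ (by positivity)]
    nlinarith
  obtain ⟨ρ, hρ, hρk⟩ := Metric.uniformContinuous_iff.mp hk.uniformContinuous ε' hε'0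
  refine ⟨ρ, hρ, fun {t t'} htt' => ?_⟩
  have key : ∀ {t t' : ℝ}, dist t t' < ρ →
      (renewalConv μ k t).toReal - (renewalConv μ k t').toReal < ε := by
    intro t t' h
    have h1 := hk.renewalConv_le_add hC (t := t) (t' := t') (ε := ε') fun y => by
      have h2 := hρk (a := t - y) (b := t' - y) (by rwa [dist_sub_right])
      rw [Real.dist_eq] at h2
      linarith [le_abs_self (k (t - y) - k (t' - y))]
    have h3 : ENNReal.ofReal ε' * C ≠ ∞ := ENNReal.mul_ne_top ENNReal.ofReal_ne_top hCtop
    have h4 := hk.renewalConv_ne_top hsupp hβ t'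
    have h5 := ENNReal.toReal_mono (ENNReal.add_ne_top.mpr ⟨h4, h3⟩) h1
    rw [ENNReal.toReal_add h4 h3, ENNReal.toReal_mul, ENNReal.toReal_ofReal hε'0.le] at h5
    linarith
  rw [Real.dist_eq, abs_lt]
  constructor
  · linarith [key (t := t') (t' := t) (by rwa [dist_comm])]
  · exact key htt'

lemma renewalConv_eq_integral (hk : IsMollifier k δ) (hsupp : μ (Iio 0) = 0)
    (hβ : 0 < firstMoment μ) {t : ℝ} (ht : δ < t) :
    (renewalConv μ k t).toReal = ∫ y, (renewalConv μ k (t - y)).toReal ∂μ := by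
  have hm : Measurable fun y => renewalConv μ k (t - y) :=
    (hk.measurable_renewalConv).comp (by fun_prop)
  rw [integral_toReal hm.aemeasurable
    (ae_of_all _ fun y => (hk.renewalConv_ne_top hsupp hβ _).lt_top)]
  have h := lintegral_renewalMeasure_eq μ (f := fun y => ENNReal.ofReal (k (t - y)))
    (hk.measurable_ofReal.comp (by fun_prop))
  rw [sub_zero, hk.eq_zero t (ht.trans_le (le_abs_self t)), ENNReal.ofReal_zero, zero_add] at h
  rw [renewalConv, h]
  congr 1
  refine lintegral_congr fun y => lintegral_congr fun x => ?_
  rw [show t - (x + y) = t - y - x by ring]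

lemma lintegral_survival_mul_renewalConv (hk : IsMollifier k δ) (hsupp : μ (Iio 0) = 0)
    (hβ : 0 < firstMoment μ) {t : ℝ} (ht : δ ≤ t) :
    ∫⁻ r, survival μ r * renewalConv μ k (t - r) = 1 := by
  have hS := measurable_survival μ
  have hkm := hk.measurable_ofReal
  refine (lintegral_mul_lintegral_sub' (renewalMeasure μ) hS hkm t).trans ?_
  rw [← hk.lintegral_eq_one]
  refine lintegral_congr fun s => ?_
  by_cases hs : k s = 0
  · simp [hs]
  · have hs' : |s| ≤ δ := by
      by_contra! h
      exact hs (hk.eq_zero s h)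
    rw [lintegral_survival_eq_one hsupp hβ (by linarith [le_abs_self s]), mul_one]

/-- Blackwell's renewal theorem, in mollified form. -/
lemma tendsto_renewalConv (hk : IsMollifier k δ) (hsupp : μ (Iio 0) = 0) (hnl : Nonlattice μ)
    (hmean : Integrable (fun x => x) μ) (hβ : 0 < firstMoment μ) :
    Tendsto (fun t => (renewalConv μ k t).toReal) atTop (𝓝 (firstMoment μ)⁻¹) := by
  obtain ⟨K, hK0, hK⟩ := hk.exists_renewalConv_le hsupp hβ
  set Z := fun t => (renewalConv μ k t).toReal with hZ
  have hZu : UniformContinuous Z := hk.uniformContinuous_renewalConv hsupp hβ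
  have hZc := hZu.continuous
  have hZK : ∀ t, |Z t| ≤ K := fun t => by
    rw [abs_of_nonneg ENNReal.toReal_nonneg]
    exact ENNReal.toReal_le_of_le_ofReal hK0 (hK t)
  have hinc := tendsto_increment hnl hsupp hZu hZK
    ((eventually_gt_atTop δ).mono fun t ht => hk.renewalConv_eq_integral hsupp hβ ht)
  have hSm := measurable_survival μ
  have hSfin : ∫⁻ r, survival μ r ≠ ∞ := by
    rw [lintegral_survival hsupp hmean]
    exact ENNReal.ofReal_ne_top
  have hSi : Integrable fun r => (survival μ r).toReal :=
    integrable_toReal_of_lintegral_ne_top hSm.aemeasurable hSfin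
  have hSint : ∫ r, (survival μ r).toReal = firstMoment μ := by
    rw [integral_toReal hSm.aemeasurable (ae_lt_top hSm hSfin), lintegral_survival hsupp hmean,
      ENNReal.toReal_ofReal hβ.le]
  have hSZi : ∀ t, Integrable fun r => (survival μ r).toReal * Z (t - r) := fun t =>
    hSi.mul_bdd (c := K) (by fun_prop) (ae_of_all _ fun r => hZK _)
  have hone : ∀ t, δ ≤ t → ∫ r, (survival μ r).toReal * Z (t - r) = 1 := by
    intro t ht
    simp only [hZ, ← ENNReal.toReal_mul]
    have hm : Measurable fun r => survival μ r * renewalConv μ k (t - r) :=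
      hSm.mul (hk.measurable_renewalConv.comp (by fun_prop))
    have h1 := hk.lintegral_survival_mul_renewalConv hsupp hβ ht
    rw [integral_toReal hm.aemeasurable (ae_lt_top hm (by rw [h1]; simp)), h1,
      ENNReal.toReal_one]
  have hlim : Tendsto (fun t => ∫ r, (survival μ r).toReal * (Z (t - r) - Z t)) atTop
      (𝓝 (∫ _r : ℝ, (0:ℝ))) := by
    refine tendsto_integral_filter_of_dominated_convergence
      (fun r => (survival μ r).toReal * (2 * K)) ?_ ?_ (hSi.mul_const _) ?_
    · refine Eventually.of_forall fun t => hSi.aestronglyMeasurable.mul ?_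
      fun_prop
    · refine Eventually.of_forall fun t => ae_of_all _ fun r => ?_
      rw [norm_mul, Real.norm_of_nonneg ENNReal.toReal_nonneg]
      gcongr
      have h1 := abs_sub (Z (t - r)) (Z t)
      rw [Real.norm_eq_abs]
      linarith [hZK (t - r), hZK t]
    · refine ae_of_all _ fun r => ?_
      simpa [sub_eq_add_neg] using (hinc (-r)).const_mul (survival μ r).toReal
  rw [integral_zero] at hlim
  have hlim' : Tendsto (fun t => 1 - firstMoment μ * Z t) atTop (𝓝 0) := by
    refine hlim.congr' ?_
    filter_upwards [eventually_ge_atTop δ] with t ht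
    simp_rw [mul_sub]
    rw [integral_sub (hSZi t) (hSi.mul_const _), hone t ht, integral_mul_const, hSint]
  have h := (hlim'.const_sub 1).const_mul (firstMoment μ)⁻¹
  simp only [sub_zero, mul_one] at h
  refine h.congr fun t => ?_
  field_simp
  ring

end IsMollifier

/-- The function equal to `h` on `[0, ∞)` and to `h 0` on `(-∞, 0)`, cut off below `c`. -/
noncomputable def truncExtend (h : ℝ → ℝ) (c : ℝ) : ℝ → ℝ≥0∞ :=
  (Ici c).indicator fun r => ENNReal.ofReal (h (max r 0))

section Sandwich

variable {h : ℝ → ℝ}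

lemma antitone_comp_max (hh : AntitoneOn h (Ici 0)) : Antitone fun r => h (max r 0) :=
  fun _ _ hrs => hh (mem_Ici.mpr (le_max_right _ _)) (mem_Ici.mpr (le_max_right _ _))
    (max_le_max hrs le_rfl)

lemma measurable_ofReal_comp_max (hh : AntitoneOn h (Ici 0)) :
    Measurable fun r => ENNReal.ofReal (h (max r 0)) :=
  (antitone_comp_max hh).measurable.ennreal_ofReal

lemma measurable_truncExtend (hh : AntitoneOn h (Ici 0)) (c : ℝ) :
    Measurable (truncExtend h c) :=
  (measurable_ofReal_comp_max hh).indicator measurableSet_Ici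

variable {μ : Measure ℝ} [IsProbabilityMeasure μ] {k : ℝ → ℝ} {δ : ℝ}

lemma IsMollifier.lintegral_mul_const (hk : IsMollifier k δ) (c : ℝ≥0∞) :
    ∫⁻ s, ENNReal.ofReal (k s) * c = c := by
  rw [MeasureTheory.lintegral_mul_const _ hk.measurable_ofReal, hk.lintegral_eq_one, one_mul]

lemma setLIntegral_renewalMeasure_le (hk : IsMollifier k δ) (hh : AntitoneOn h (Ici 0)) (t : ℝ) :
    ∫⁻ y in Icc 0 t, ENNReal.ofReal (h (t - y)) ∂renewalMeasure μ ≤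
      ∫⁻ r, truncExtend h (-(2 * δ)) r * renewalConv μ k (t - δ - r) := by
  refine le_trans ?_ (lintegral_mul_lintegral_sub (renewalMeasure μ)
    (measurable_truncExtend hh _) hk.measurable_ofReal (t - δ)).ge
  refine le_trans (setLIntegral_mono' measurableSet_Icc fun y hy => ?_)
    (setLIntegral_le_lintegral _ _)
  rw [← hk.lintegral_mul_const (ENNReal.ofReal (h (t - y)))]
  refine lintegral_mono fun s => ?_
  by_cases hs : |s| ≤ δ
  · obtain ⟨h1, h2⟩ := abs_le.mp hs
    rw [truncExtend, indicator_of_mem (by simp only [mem_Ici]; linarith [hy.2])]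
    gcongr
    exact hh (mem_Ici.mpr (le_max_right _ _)) (sub_nonneg.mpr hy.2)
      (max_le (by linarith) (sub_nonneg.mpr hy.2))
  · simp [hk.eq_zero s (not_le.mp hs)]

lemma le_setLIntegral_renewalMeasure (hk : IsMollifier k δ) (hh : AntitoneOn h (Ici 0))
    (hsupp : μ (Iio 0) = 0) (t : ℝ) :
    ∫⁻ r, truncExtend h (2 * δ) r * renewalConv μ k (t + δ - r) ≤
      ∫⁻ y in Icc 0 t, ENNReal.ofReal (h (t - y)) ∂renewalMeasure μ := by
  refine (lintegral_mul_lintegral_sub (renewalMeasure μ)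
    (measurable_truncExtend hh _) hk.measurable_ofReal (t + δ)).le.trans ?_
  rw [← lintegral_indicator measurableSet_Icc]
  refine lintegral_mono_ae ?_
  filter_upwards [measure_eq_zero_iff_ae_notMem.mp (renewalMeasure_Iio_zero hsupp)] with y hy
  rw [← hk.lintegral_mul_const (indicator _ _ _)]
  refine lintegral_mono fun s => ?_
  by_cases hs : |s| ≤ δ
  · obtain ⟨h1, h2⟩ := abs_le.mp hs
    gcongr
    rw [truncExtend, indicator_apply]
    split_ifs with hmem
    swap
    · exact zero_le
    simp only [mem_Ici, mem_Iio, not_lt] at hmem hy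
    have hyt : y ≤ t := by linarith
    rw [indicator_of_mem (mem_Icc.mpr ⟨hy, hyt⟩)]
    exact ENNReal.ofReal_le_ofReal (hh (sub_nonneg.mpr hyt) (mem_Ici.mpr (le_max_right _ _))
      (le_max_of_le_left (by linarith)))
  · simp [hk.eq_zero s (not_le.mp hs)]

variable {M : ℝ}

lemma lintegral_truncExtend_le (hM : h 0 ≤ M) (hδ : 0 ≤ δ) :
    ∫⁻ r, truncExtend h (-(2 * δ)) r ≤
      ENNReal.ofReal (2 * δ * M) + ∫⁻ y in Ici 0, ENNReal.ofReal (h y) := by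
  calc ∫⁻ r, truncExtend h (-(2 * δ)) r
      ≤ ∫⁻ r, ((Ico (-(2 * δ)) 0).indicator (fun _ => ENNReal.ofReal M) r +
          (Ici 0).indicator (fun r => ENNReal.ofReal (h r)) r) := by
        refine lintegral_mono fun r => ?_
        rw [truncExtend, indicator_apply]
        split_ifs with hr
        swap
        · exact zero_le
        rcases lt_or_ge r 0 with h0 | h0
        · rw [indicator_of_mem (mem_Ico.mpr ⟨hr, h0⟩),
            max_eq_right h0.le]
          exact (ENNReal.ofReal_le_ofReal hM).trans le_self_add
        · rw [indicator_of_mem (s := Ici 0) h0, max_eq_left h0]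
          exact le_add_self
    _ = _ := by
        rw [lintegral_add_left (measurable_const.indicator measurableSet_Ico),
          lintegral_indicator_const measurableSet_Ico, lintegral_indicator measurableSet_Ici,
          Real.volume_Ico, mul_comm, ← ENNReal.ofReal_mul (by linarith)]
        congr 3
        ring

lemma setLIntegral_le_add_tail (hh : AntitoneOn h (Ici 0)) (hM : h 0 ≤ M) {a : ℝ} (ha : 0 ≤ a) :
    ∫⁻ y in Ici 0, ENNReal.ofReal (h y) ≤
      ENNReal.ofReal (a * M) + ∫⁻ y in Ioi a, ENNReal.ofReal (h y) := by
  rw [← Icc_union_Ioi_eq_Ici ha]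
  refine (lintegral_union_le _ _ _).trans ?_
  gcongr
  refine (setLIntegral_mono' (g := fun _ => ENNReal.ofReal M) measurableSet_Icc fun y hy =>
    ENNReal.ofReal_le_ofReal ((hh self_mem_Ici hy.1 hy.1).trans hM)).trans (le_of_eq ?_)
  rw [setLIntegral_const, Real.volume_Icc, mul_comm, ← ENNReal.ofReal_mul (by linarith), sub_zero]

lemma lintegral_truncExtend_mul_le (hh : AntitoneOn h (Ici 0)) {Z : ℝ → ℝ≥0∞} {A K : ℝ≥0∞}
    {c R T : ℝ} (hR : 0 ≤ R) (hA : ∀ s ≥ T, Z s ≤ A) (hK : ∀ s, Z s ≤ K) {t : ℝ}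
    (ht : T + R ≤ t) :
    ∫⁻ r, truncExtend h c r * Z (t - r) ≤
      (∫⁻ r, truncExtend h c r) * A + (∫⁻ y in Ioi R, ENNReal.ofReal (h y)) * K := by
  have hEm := measurable_truncExtend hh c
  have htail : ∫⁻ y in Ioi R, ENNReal.ofReal (h y)
      = ∫⁻ y in Ioi R, ENNReal.ofReal (h (max y 0)) := by
    refine setLIntegral_congr_fun measurableSet_Ioi fun y hy => ?_
    rw [max_eq_left (hR.trans (le_of_lt hy))]
  have hTm := (measurable_ofReal_comp_max hh).indicator (measurableSet_Ioi (a := R))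
  rw [htail, ← lintegral_indicator measurableSet_Ioi, ← lintegral_mul_const _ hEm,
    ← lintegral_mul_const _ hTm, ← lintegral_add_left (hEm.mul_const _)]
  refine lintegral_mono fun r => ?_
  rcases le_or_gt r R with hr | hr
  · refine le_trans ?_ le_self_add
    gcongr
    exact hA _ (by linarith)
  · refine le_trans ?_ le_add_self
    gcongr
    · rw [indicator_of_mem (mem_Ioi.mpr hr)]
      exact indicator_le_self _ _ r
    · exact hK _

lemma setLIntegral_mul_le (hh : AntitoneOn h (Ici 0)) (hM : h 0 ≤ M) {Z : ℝ → ℝ≥0∞} {A : ℝ≥0∞}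
    {c R T : ℝ} (hc : 0 ≤ c) (hcR : c ≤ R) (hA : ∀ s ≥ T, A ≤ Z s) {t : ℝ} (ht : T + R ≤ t) :
    (∫⁻ y in Ici 0, ENNReal.ofReal (h y)) * A ≤
      (ENNReal.ofReal (c * M) + ∫⁻ y in Ioi R, ENNReal.ofReal (h y)) * A +
        ∫⁻ r, truncExtend h c r * Z (t - r) := by
  have h1 : ∫⁻ y in Ioi c, ENNReal.ofReal (h y) ≤
      (∫⁻ y in Ioc c R, ENNReal.ofReal (h (max y 0))) +
        ∫⁻ y in Ioi R, ENNReal.ofReal (h y) := by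
    rw [← Ioc_union_Ioi_eq_Ioi hcR]
    refine (lintegral_union_le _ _ _).trans (add_le_add_left (le_of_eq ?_) _)
    refine setLIntegral_congr_fun measurableSet_Ioc fun y hy => ?_
    rw [max_eq_left (hc.trans hy.1.le)]
  have h2 : (∫⁻ y in Ioc c R, ENNReal.ofReal (h (max y 0))) * A ≤
      ∫⁻ r, truncExtend h c r * Z (t - r) := by
    rw [← lintegral_mul_const _ (measurable_ofReal_comp_max hh)]
    refine (setLIntegral_mono' measurableSet_Ioc fun r hr => ?_).trans
      (setLIntegral_le_lintegral _ _)
    rw [truncExtend, indicator_of_mem (s := Ici c) hr.1.le]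
    gcongr
    exact hA _ (by linarith [hr.2])
  calc _ ≤ (ENNReal.ofReal (c * M) + ((∫⁻ y in Ioc c R, ENNReal.ofReal (h (max y 0))) +
        ∫⁻ y in Ioi R, ENNReal.ofReal (h y))) * A := by
        gcongr
        exact (setLIntegral_le_add_tail hh hM hc).trans (by gcongr)
    _ = (ENNReal.ofReal (c * M) + ∫⁻ y in Ioi R, ENNReal.ofReal (h y)) * A +
        (∫⁻ y in Ioc c R, ENNReal.ofReal (h (max y 0))) * A := by ring
    _ ≤ _ := by gcongr

end Sandwich

/-- **Key renewal theorem with uniform convergence** (Lemma B.1): for a family `ℋ` of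
nonnegative nonincreasing functions with `sup_{h∈ℋ} h(0) < ∞` and uniformly vanishing
tail integrals, `(U*h)(x) → (1/β)∫₀^∞ h(y) dy` uniformly in `h ∈ ℋ` as `x → ∞`. -/
theorem key_renewal_uniform
    (H : Set (ℝ → ℝ))
    (hnn : ∀ h ∈ H, ∀ y : ℝ, 0 ≤ y → 0 ≤ h y)
    (hmono : ∀ h ∈ H, AntitoneOn h (Set.Ici 0))
    (hbd : ∃ M₁ : ℝ, ∀ h ∈ H, h 0 ≤ M₁)
    (htail : ∀ ε > (0:ℝ), ∃ x₀ : ℝ, ∀ x ≥ x₀, ∀ h ∈ H,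
      (∫⁻ y in Set.Ioi x, ENNReal.ofReal (h y)) ≤ ENNReal.ofReal ε)
    (μ : Measure ℝ) [IsProbabilityMeasure μ]
    (hsupp : μ (Set.Iio 0) = 0) (hnl : Nonlattice μ)
    (hmean : Integrable (fun x => x) μ) (hβ : 0 < firstMoment μ) :
    ∀ ε > (0:ℝ), ∃ x₀ : ℝ, ∀ x ≥ x₀, ∀ h ∈ H,
      |(∫⁻ y in Set.Icc 0 x, ENNReal.ofReal (h (x - y)) ∂renewalMeasure μ).toReal
        - (firstMoment μ)⁻¹ * (∫⁻ y in Set.Ici 0, ENNReal.ofReal (h y)).toReal| ≤ ε := by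
  obtain ⟨M₁, hM₁⟩ := hbd
  set M := max M₁ 0
  have hM0 : 0 ≤ M := le_max_right _ _
  have hM : ∀ h ∈ H, h 0 ≤ M := fun h hh => (hM₁ h hh).trans (le_max_left _ _)
  obtain ⟨B, hB0, hB⟩ : ∃ B : ℝ, 0 ≤ B ∧
      ∀ h ∈ H, ∫⁻ y in Set.Ici 0, ENNReal.ofReal (h y) ≤ ENNReal.ofReal B := by
    obtain ⟨x₀, hx₀⟩ := htail 1 one_pos
    have hx0 : 0 ≤ max x₀ 0 := le_max_right _ _
    refine ⟨max x₀ 0 * M + 1, by positivity, fun h hh => ?_⟩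
    rw [ENNReal.ofReal_add (by positivity) zero_le_one]
    refine (setLIntegral_le_add_tail (hmono h hh) (hM h hh) hx0).trans ?_
    gcongr
    exact hx₀ _ (le_max_left _ _) h hh
  intro ε hε
  set m := (firstMoment μ)⁻¹
  have hm0 : 0 < m := inv_pos.mpr hβ
  set δ := ε / (4 * (m * M + 1))
  have hδ : 0 < δ := by positivity
  have hδε : m * (2 * δ * M) ≤ ε / 2 := by
    have h1 : δ * (4 * (m * M + 1)) = ε := div_mul_cancel₀ _ (by positivity)
    nlinarith
  obtain ⟨k, hk⟩ := exists_isMollifier hδ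
  obtain ⟨K, hK0, hK⟩ := hk.exists_renewalConv_le hsupp hβ
  set S := 2 * δ * M + B + K + m + 1 with hS
  have hS0 : 0 < S := by positivity
  set η := min m (ε / (2 * S))
  have hη0 : 0 < η := lt_min hm0 (by positivity)
  have hηm : η ≤ m := min_le_left _ _
  have hηS : η * S ≤ ε / 2 := by
    have h1 : η * (2 * S) ≤ ε := (le_div_iff₀ (by positivity)).mp (min_le_right _ _)
    linarith
  obtain ⟨R₀, hR₀⟩ := htail η hη0
  set R := max R₀ (2 * δ)
  have hδR : 2 * δ ≤ R := le_max_right _ _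
  have hR0 : 0 ≤ R := le_trans (by positivity) hδR
  have hR : ∀ h ∈ H, ∫⁻ y in Set.Ioi R, ENNReal.ofReal (h y) ≤ ENNReal.ofReal η :=
    hR₀ R (le_max_left _ _)
  have hlim := hk.tendsto_renewalConv hsupp hnl hmean hβ
  obtain ⟨T, hT⟩ := eventually_atTop.mp (Metric.tendsto_nhds.mp hlim η hη0)
  have hTle : ∀ s ≥ T, renewalConv μ k s ≤ ENNReal.ofReal (m + η) := fun s hs => by
    rw [ENNReal.le_ofReal_iff_toReal_le (hk.renewalConv_ne_top hsupp hβ s) (by positivity)]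
    have h1 := (abs_lt.mp (hT s hs)).2
    linarith
  have hTge : ∀ s ≥ T, ENNReal.ofReal (m - η) ≤ renewalConv μ k s := fun s hs => by
    rw [ENNReal.ofReal_le_iff_le_toReal (hk.renewalConv_ne_top hsupp hβ s)]
    have h1 := (abs_lt.mp (hT s hs)).1
    linarith
  refine ⟨T + R + δ, fun x hx h hh => ?_⟩
  have hup := (setLIntegral_renewalMeasure_le (μ := μ) hk (hmono h hh) x).trans
    (lintegral_truncExtend_mul_le (hmono h hh) hR0 hTle hK (by linarith))
  have hlo := (setLIntegral_mul_le (hmono h hh) (hM h hh) (by positivity) hδR hTge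
    (t := x + δ) (by linarith)).trans
    (add_le_add_right (le_setLIntegral_renewalMeasure hk (hmono h hh) hsupp x) _)
  set A := ∫⁻ y in Set.Icc 0 x, ENNReal.ofReal (h (x - y)) ∂renewalMeasure μ
  have hI := hB h hh
  have hItop : ∫⁻ y in Set.Ici 0, ENNReal.ofReal (h y) ≠ ∞ :=
    ne_top_of_le_ne_top ENNReal.ofReal_ne_top hI
  have htrunc := lintegral_truncExtend_le (hM h hh) hδ.le
  set I := ∫⁻ y in Set.Ici 0, ENNReal.ofReal (h y)
  obtain ⟨i, hi0, hi⟩ : ∃ i : ℝ, 0 ≤ i ∧ I = ENNReal.ofReal i :=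
    ⟨I.toReal, ENNReal.toReal_nonneg, (ENNReal.ofReal_toReal hItop).symm⟩
  have hiB : i ≤ B := by rwa [hi, ENNReal.ofReal_le_ofReal_iff hB0] at hI
  have hup' : A ≤ ENNReal.ofReal ((2 * δ * M + i) * (m + η) + η * K) := by
    rw [ENNReal.ofReal_add (by positivity) (by positivity), ENNReal.ofReal_mul (by positivity),
      ENNReal.ofReal_mul hη0.le, ENNReal.ofReal_add (by positivity) hi0, ← hi]
    refine hup.trans ?_
    gcongr
    exact hR h hh
  have hAtop : A ≠ ∞ := ne_top_of_le_ne_top ENNReal.ofReal_ne_top hup'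
  obtain ⟨a, ha0, ha⟩ : ∃ a : ℝ, 0 ≤ a ∧ A = ENNReal.ofReal a :=
    ⟨A.toReal, ENNReal.toReal_nonneg, (ENNReal.ofReal_toReal hAtop).symm⟩
  have hmη : 0 ≤ m - η := sub_nonneg.mpr hηm
  have hlo' : ENNReal.ofReal (i * (m - η)) ≤
      ENNReal.ofReal ((2 * δ * M + η) * (m - η) + a) := by
    rw [ENNReal.ofReal_add (by positivity) ha0, ENNReal.ofReal_mul hi0,
      ENNReal.ofReal_mul (by positivity : 0 ≤ 2 * δ * M + η),
      ENNReal.ofReal_add (by positivity) hη0.le, ← hi, ← ha]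
    refine hlo.trans ?_
    gcongr
    exact hR h hh
  rw [ha, ENNReal.ofReal_le_ofReal_iff (by positivity)] at hup'
  rw [ENNReal.ofReal_le_ofReal_iff (by positivity)] at hlo'
  rw [ha, hi, ENNReal.toReal_ofReal ha0, ENNReal.toReal_ofReal hi0, abs_le]
  have hδM : 0 ≤ 2 * δ * M := by positivity
  have h1 : η * i ≤ η * B := by gcongr
  have h2 : 0 ≤ η * K := by positivity
  have h3 : 0 ≤ η * m := by positivity
  have h4 : 0 ≤ η * (2 * δ * M) := by positivity
  have h5 : 0 ≤ η * η := by positivity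
  have h6 : η * S = η * (2 * δ * M) + η * B + η * K + η * m + η := by rw [hS]; ring
  constructor <;> nlinarith
end

section
/- Let K>0 and let ν be a probability measure on [0,∞) with finite positive mean β=∫x ν(dx); let ν_e be its equilibrium measure with mean β_e > 0. Then the lifting map Δ_{K,ν} is Lipschitz from [0,∞) into M×M: for all w₁, w₂ ≥ 0, the maximum of the Prohorov distances between the respective components of Δ_{K,ν}w₁ and Δ_{K,ν}w₂ is at most max(1/β, 1/β_e)·|w₁ − w₂|. -/
open MeasureTheory Set Filter
open scoped ENNReal NNReal Topology

/-- `(ξ, μ)` is a valid initial condition for the fluid model with sharing limit `K` and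
job-size distribution `ν`:  `ξ = (⟨1,ξ⟩+⟨1,μ⟩−K)⁺ ν` and `⟨1,μ⟩ = (⟨1,ξ⟩+⟨1,μ⟩) ∧ K`. -/
def ValidInit (K : ℝ) (ν ξ μ : Measure ℝ) : Prop :=
  IsFiniteMeasure ξ ∧ IsFiniteMeasure μ ∧
  ξ (Set.Iio 0) = 0 ∧ μ (Set.Iio 0) = 0 ∧
  ξ = ENNReal.ofReal (max (totalMass ξ + totalMass μ - K) 0) • ν ∧
  totalMass μ = min (totalMass ξ + totalMass μ) K

/-- The lifting map `Δ_{K,ν} w = ( ((w−Kβ_e)⁺/β)·ν , ((w∧Kβ_e)/β_e)·ν_e )`. -/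
noncomputable def liftMap (K : ℝ) (ν : Measure ℝ) (w : ℝ) : Measure ℝ × Measure ℝ :=
  (ENNReal.ofReal (max (w - K * meanE ν) 0 / firstMoment ν) • ν,
   ENNReal.ofReal (min w (K * meanE ν) / meanE ν) • eqMeasure ν)

/-- The metric on `M × M`: the maximum of the componentwise Prohorov metrics. -/
noncomputable def pairDist (p q : Measure ℝ × Measure ℝ) : ℝ :=
  max (levyProkhorovDist p.1 q.1) (levyProkhorovDist p.2 q.2)

theorem levyProkhorovDist_smul_le {m : Measure ℝ} (hm : m univ ≤ 1) (a b : ℝ) :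
    levyProkhorovDist (ENNReal.ofReal a • m) (ENNReal.ofReal b • m) ≤ |a - b| := by
  refine ENNReal.toReal_le_of_le_ofReal (abs_nonneg _)
    (levyProkhorovEDist_le_of_forall _ _ _ fun ε B hε hε' _ => ?_)
  have hsub : B ⊆ Metric.thickening ε.toReal B :=
    Metric.self_subset_thickening (ENNReal.toReal_pos (pos_of_gt hε).ne' hε'.ne) B
  have hB : m B ≤ 1 := (measure_mono (subset_univ B)).trans hm
  have key (x y : ℝ) (hxy : ENNReal.ofReal |x - y| < ε) :
      (ENNReal.ofReal x • m) B ≤ (ENNReal.ofReal y • m) (Metric.thickening ε.toReal B) + ε := by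
    have h : ENNReal.ofReal x ≤ ENNReal.ofReal y + ENNReal.ofReal |x - y| :=
      (ENNReal.ofReal_le_ofReal (by linarith [le_abs_self (x - y)])).trans ENNReal.ofReal_add_le
    simp only [Measure.smul_apply, smul_eq_mul]
    calc ENNReal.ofReal x * m B
        ≤ (ENNReal.ofReal y + ENNReal.ofReal |x - y|) * m B := by gcongr
      _ = ENNReal.ofReal y * m B + ENNReal.ofReal |x - y| * m B := add_mul _ _ _
      _ ≤ ENNReal.ofReal y * m (Metric.thickening ε.toReal B) + ε :=
          add_le_add (by gcongr) ((mul_le_of_le_one_right' hB).trans hxy.le)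
  exact ⟨key a b hε, key b a (by rwa [abs_sub_comm])⟩

theorem eqMeasure_univ {ν : Measure ℝ} (hsupp : ν (Iio 0) = 0)
    (hmean : Integrable (fun x => x) ν) (hβ : 0 < firstMoment ν) :
    eqMeasure ν univ = 1 := by
  have hnn : 0 ≤ᵐ[ν] fun x => x := by
    rw [Filter.EventuallyLE, ae_iff]
    simpa [Iio_def] using hsupp
  have hint : ∫⁻ y in Ici (0 : ℝ), ν (Ioi y) = ENNReal.ofReal (firstMoment ν) := by
    rw [firstMoment, ofReal_integral_eq_lintegral_ofReal hmean hnn,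
      lintegral_eq_lintegral_meas_lt ν hnn hmean.aemeasurable, ← restrict_Ioi_eq_restrict_Ici]
    rfl
  rw [eqMeasure, Measure.smul_apply, withDensity_apply _ MeasurableSet.univ, Measure.restrict_univ,
    hint, smul_eq_mul]
  exact ENNReal.inv_mul_cancel (by simpa using hβ) ENNReal.ofReal_ne_top

/-- **Lipschitz continuity of the lifting map** `Δ_{K,ν}`: for `w₁, w₂ ≥ 0`, the maximum
of the componentwise Prohorov distances between `Δ_{K,ν} w₁` and `Δ_{K,ν} w₂` is at most
`max(1/β, 1/β_e)·|w₁ − w₂|`. -/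
theorem liftMap_lipschitz
    (K : ℝ) (hK : 0 < K)
    (ν : Measure ℝ) [IsProbabilityMeasure ν] (hsupp : ν (Set.Iio 0) = 0)
    (hmean : Integrable (fun x => x) ν)
    (hβ : 0 < firstMoment ν) (hβe : 0 < meanE ν) :
    ∀ w₁ w₂ : ℝ, 0 ≤ w₁ → 0 ≤ w₂ →
      pairDist (liftMap K ν w₁) (liftMap K ν w₂) ≤
        max (firstMoment ν)⁻¹ (meanE ν)⁻¹ * |w₁ - w₂| := by
  intro w₁ w₂ _ _
  have scale {c x y : ℝ} (hc : 0 < c) (hxy : |x - y| ≤ |w₁ - w₂|)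
      (hle : c⁻¹ ≤ max (firstMoment ν)⁻¹ (meanE ν)⁻¹) :
      |x / c - y / c| ≤ max (firstMoment ν)⁻¹ (meanE ν)⁻¹ * |w₁ - w₂| := by
    rw [← sub_div, abs_div, abs_of_pos hc, div_eq_inv_mul]
    gcongr
  refine max_le ?_ ?_
  · refine (levyProkhorovDist_smul_le prob_le_one _ _).trans (scale hβ ?_ (le_max_left _ _))
    simpa using abs_max_sub_max_le_abs (w₁ - K * meanE ν) (w₂ - K * meanE ν) 0
  · refine (levyProkhorovDist_smul_le (eqMeasure_univ hsupp hmean hβ).le _ _).trans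
      (scale hβe ?_ (le_max_right _ _))
    simpa using abs_min_sub_min_le_max w₁ (K * meanE ν) w₂ (K * meanE ν)
end
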